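/- For every ε > 0 there exists n₀ ∈ ℕ such that for all n ≥ n₀, the number of independent sets in the discrete torus Z_3^n satisfies |II(Z_3^n)| ≥ (1 − ε) · 3 · 2^(n−1) · 2^(3^(n−1)) · exp((3/2)^(n−1)). -/

import Mathlib

/-- The discrete torus `Z_m^n`: the graph on `(ZMod m)^n` where two vertices are adjacent
iff they differ by `±1 (mod m)` in exactly one coordinate. -/
def torus (m n : ℕ) : SimpleGraph (Fin n → ZMod m) :=
  SimpleGraph.fromRel fun u v =>
    ∃ j : Fin n, (u j = v j + 1 ∨ u j = v j - 1) ∧ ∀ i : Fin n, i ≠ j → u i = v i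

/-- A set of vertices is independent if its vertices are pairwise non-adjacent. -/
def IsIndep {V : Type*} (G : SimpleGraph V) (s : Set V) : Prop :=
  s.Pairwise fun u v => ¬ G.Adj u v

/-- `N_G(X) := (⋃ x ∈ X, N_G(x)) \ X`. -/
def nbhd {V : Type*} (G : SimpleGraph V) (X : Set V) : Set V :=
  (⋃ x ∈ X, G.neighborSet x) \ X

/-- `N_G(X, Y) := N_G(X) ∩ Y`. -/
def nbhdIn {V : Type*} (G : SimpleGraph V) (X Y : Set V) : Set V :=
  nbhd G X ∩ Y

/-- `E_m^n(p)`: the vertices of `Z_m^n` whose coordinate sum is `p` modulo `m`. -/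
def Eclass (m n : ℕ) (p : ZMod m) : Set (Fin n → ZMod m) :=
  {v | ∑ i, v i = p}

/-- A maximum independent set: an independent set of the largest possible cardinality. -/
def MaxIndep {V : Type*} (G : SimpleGraph V) (s : Set V) : Prop :=
  IsIndep G s ∧ ∀ t : Set V, IsIndep G t → t.ncard ≤ s.ncard

open Finset in
lemma aux_sup {V : Type*} [DecidableEq V] (W D : Finset V) (x : ℝ) (hx : 0 ≤ x) :
    ∑ S ∈ W.powerset with D ⊆ S, x ^ #S ≤ x ^ #D * (1 + x) ^ #W := by
  have h1 : ∑ S ∈ W.powerset with D ⊆ S, x ^ #S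
      = ∑ R ∈ (W.powerset.filter (fun S => D ⊆ S)).image (fun S => S \ D), x ^ #D * x ^ #R := by
    rw [sum_image]
    · apply sum_congr rfl
      intro S hS
      rw [mem_filter] at hS
      rw [← pow_add, add_comm, card_sdiff_add_card_eq_card hS.2]
    · intro S hS T hT h
      simp only [coe_filter, Set.mem_ofPred_eq] at hS hT
      have h' : S \ D = T \ D := h
      rw [← sdiff_union_of_subset hS.2, h', sdiff_union_of_subset hT.2]
  rw [h1, ← mul_sum]
  apply mul_le_mul_of_nonneg_left _ (by positivity)
  calc _ ≤ ∑ R ∈ W.powerset, x ^ #R := by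
        apply sum_le_sum_of_subset_of_nonneg
        · intro R hR
          simp only [mem_image, mem_filter, mem_powerset] at hR ⊢
          obtain ⟨S, ⟨h, -⟩, rfl⟩ := hR
          exact sdiff_subset.trans h
        · intros; positivity
    _ = _ := by
        have := sum_pow_mul_eq_add_pow x 1 W
        simp only [one_pow, mul_one] at this
        rw [this, add_comm]

open Finset Classical in
lemma aux_fiber {V : Type*} [Fintype V] (G : SimpleGraph V) (I S : Finset V) (d : ℕ)
    (hI : IsIndep G (I : Set V)) (hS : IsIndep G (S : Set V)) (hSI : Disjoint S I)
    (hd : ∀ v ∈ S, #(I.filter (fun u => G.Adj v u)) ≤ d) :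
    (2 : ℝ) ^ #I * ((1 / 2 : ℝ) ^ d) ^ #S ≤
      (#(univ.filter (fun T : Finset V => IsIndep G (T : Set V) ∧ T \ I = S)) : ℝ) := by
  set N := S.biUnion (fun v => I.filter (fun u => G.Adj v u)) with hN
  have hNc : #N ≤ #S * d := card_biUnion_le_card_mul _ _ _ hd
  have hc : #I ≤ #(I \ N) + #S * d := by
    have := le_card_sdiff N I
    omega
  have h2 : 2 ^ #(I \ N) ≤
      #(univ.filter (fun T : Finset V => IsIndep G (T : Set V) ∧ T \ I = S)) := by
    rw [← card_powerset]
    apply card_le_card_of_injOn (fun R => S ∪ R)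
    · intro R hR
      simp only [coe_powerset, Set.mem_preimage, Set.mem_powerset_iff, coe_subset] at hR
      have hRI : R ⊆ I := hR.trans sdiff_subset
      have hno : ∀ v ∈ S, ∀ u ∈ R, ¬ G.Adj v u := by
        intro v hv u hu h
        have := hR hu
        rw [mem_sdiff] at this
        apply this.2
        rw [hN, mem_biUnion]
        exact ⟨v, hv, by simp [this.1, h]⟩
      simp only [coe_filter, Set.mem_ofPred_eq, mem_univ, true_and]
      constructor
      · intro u hu v hv huv
        simp only [coe_union, Set.mem_union, mem_coe] at hu hv
        rcases hu with hu | hu <;> rcases hv with hv | hv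
        · exact hS hu hv huv
        · exact hno u hu v hv
        · exact fun h => hno v hv u hu h.symm
        · exact hI (hRI hu) (hRI hv) huv
      · rw [union_sdiff_distrib, sdiff_eq_self_of_disjoint hSI, sdiff_eq_empty_iff_subset.2 hRI,
          union_empty]
    · intro R hR R' hR' h
      simp only [coe_powerset, Set.mem_preimage, Set.mem_powerset_iff, coe_subset] at hR hR'
      have hd1 : ∀ R, R ⊆ I \ N → (S ∪ R) \ S = R := by
        intro R hR
        rw [union_sdiff_left]
        exact sdiff_eq_self_of_disjoint (hSI.mono_right (hR.trans sdiff_subset)).symm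
      have h' : S ∪ R = S ∪ R' := h
      rw [← hd1 R hR, h', hd1 R' hR']
  calc (2 : ℝ) ^ #I * ((1 / 2 : ℝ) ^ d) ^ #S ≤ 2 ^ (#(I \ N) + #S * d) * ((1 / 2 : ℝ) ^ d) ^ #S := by
        gcongr
        norm_num
    _ = 2 ^ #(I \ N) := by
        rw [← pow_mul, pow_add, mul_comm d, mul_assoc, ← mul_pow]
        norm_num
    _ ≤ _ := by exact_mod_cast h2

open Finset Classical in
noncomputable def smallDef {V : Type*} [Fintype V] (G : SimpleGraph V) (K : ℕ) (I : Finset V) :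
    Finset (Finset V) :=
  univ.filter (fun T : Finset V => IsIndep G (T : Set V) ∧ #(T \ I) ≤ K)

open Finset Classical in
lemma aux_class {V : Type*} [Fintype V] (G : SimpleGraph V) (I : Finset V) (d D K : ℕ) (hK : 0 < K)
    (hI : IsIndep G (I : Set V))
    (hd : ∀ v, v ∉ I → #(I.filter (fun u => G.Adj v u)) ≤ d)
    (hD : ∀ v, #(univ.filter (fun u => G.Adj v u)) ≤ D) (x : ℝ) (hx : x = (1 / 2 : ℝ) ^ d) :
    (2 : ℝ) ^ #I * ((1 + x) ^ #Iᶜ * (1 - #Iᶜ * D * x ^ 2 - #Iᶜ * x / K)) ≤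
      (#(smallDef G K I) : ℝ) := by
  have hx0 : 0 ≤ x := by rw [hx]; positivity
  set W := Iᶜ with hW
  set good := W.powerset.filter (fun S : Finset V => IsIndep G (S : Set V) ∧ #S ≤ K) with hgood
  set P := (W ×ˢ (univ : Finset V)).filter (fun p => G.Adj p.1 p.2) with hP
  have hPc : (#P : ℝ) ≤ #W * D := by
    have : #P ≤ #W * D := by
      have : P = W.biUnion (fun v => (univ.filter (fun u => G.Adj v u)).image (fun u => (v, u))) := by
        ext ⟨a, b⟩
        simp [hP]
      rw [this]
      apply card_biUnion_le_card_mul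
      intro v _
      exact card_image_le.trans (hD v)
    exact_mod_cast this
  have e1 : (∑ S ∈ good, (2 : ℝ) ^ #I * x ^ #S) ≤ (#(smallDef G K I) : ℝ) := by
    have : #(smallDef G K I) = ∑ S ∈ good, #((smallDef G K I).filter (fun T => T \ I = S)) := by
      apply card_eq_sum_card_fiberwise
      intro T hT
      simp only [smallDef, coe_filter, mem_univ, true_and, Set.mem_ofPred_eq] at hT
      simp only [hgood, coe_filter, mem_powerset, Set.mem_ofPred_eq]
      refine ⟨?_, ?_, hT.2⟩
      · intro v hv
        rw [mem_sdiff] at hv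
        simp [hW, hv.2]
      · exact hT.1.mono (by simp)
    rw [this, Nat.cast_sum]
    apply sum_le_sum
    intro S hS
    simp only [hgood, mem_filter, mem_powerset] at hS
    have hdis : Disjoint S I := by
      rw [← le_compl_iff_disjoint_right]; exact hS.1
    have := aux_fiber G I S d hI hS.2.1 hdis (fun v hv => hd v (disjoint_left.1 hdis hv))
    rw [← hx] at this
    refine this.trans ?_
    norm_cast
    apply card_le_card
    intro T hT
    simp only [mem_filter, mem_univ, true_and, smallDef] at hT ⊢
    exact ⟨⟨hT.1, hT.2 ▸ hS.2.2⟩, hT.2⟩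
  refine le_trans ?_ e1
  rw [← mul_sum]
  apply mul_le_mul_of_nonneg_left _ (by positivity)
  have hKr : (0 : ℝ) < K := by exact_mod_cast hK
  have tot : ∑ S ∈ W.powerset, x ^ #S = (1 + x) ^ #W := by
    have := sum_pow_mul_eq_add_pow x 1 W
    simp only [one_pow, mul_one] at this
    rw [this, add_comm]
  have key : ∀ S ∈ W.powerset, x ^ #S ≤ (if IsIndep G (S : Set V) ∧ #S ≤ K then x ^ #S else 0)
      + (∑ p ∈ P, if {p.1, p.2} ⊆ S then x ^ #S else 0)
      + (∑ v ∈ W, if {v} ⊆ S then x ^ #S else 0) / K := by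
    intro S hS
    rw [mem_powerset] at hS
    have hxS : 0 ≤ x ^ #S := by positivity
    have n1 : 0 ≤ (if IsIndep G (S : Set V) ∧ #S ≤ K then x ^ #S else 0) := by split_ifs <;> simp [hxS]
    have n2 : 0 ≤ (∑ p ∈ P, if {p.1, p.2} ⊆ S then x ^ #S else 0) :=
      sum_nonneg (fun p _ => by split_ifs <;> simp [hxS])
    have n3 : (∑ v ∈ W, if {v} ⊆ S then x ^ #S else 0) = #S * x ^ #S := by
      rw [← sum_filter, sum_const, nsmul_eq_mul]
      congr 3
      ext v
      simp only [mem_filter, singleton_subset_iff]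
      exact ⟨fun h => h.2, fun h => ⟨hS h, h⟩⟩
    have n4 : 0 ≤ #S * x ^ #S / K := by positivity
    rw [n3]
    by_cases hi : IsIndep G (S : Set V)
    · by_cases hk : #S ≤ K
      · rw [if_pos ⟨hi, hk⟩]; linarith
      · have : x ^ #S ≤ #S * x ^ #S / K := by
          rw [le_div_iff₀ hKr, mul_comm]
          apply mul_le_mul_of_nonneg_right _ hxS
          exact_mod_cast (not_le.1 hk).le
        linarith
    · unfold IsIndep Set.Pairwise at hi
      push Not at hi
      obtain ⟨u, hu, v, hv, huv, hadj⟩ := hi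
      have hmem : (u, v) ∈ P := by
        simp only [hP, mem_filter, mem_product, mem_univ, and_true]
        exact ⟨hS hu, hadj⟩
      have := single_le_sum (f := fun p : V × V => if {p.1, p.2} ⊆ S then x ^ #S else 0)
        (fun p _ => by split_ifs <;> simp [hxS]) hmem
      have hsub : ({u, v} : Finset V) ⊆ S := by
        intro w hw
        simp only [mem_insert, mem_singleton] at hw
        rcases hw with rfl | rfl
        · exact hu
        · exact hv
      simp only [if_pos hsub] at this
      linarith
  have ks := sum_le_sum key
  rw [sum_add_distrib, sum_add_distrib, tot, ← sum_filter, ← sum_div, sum_comm,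
    sum_comm (s := W.powerset) (t := W)] at ks
  have b1 : ∑ p ∈ P, ∑ S ∈ W.powerset, (if {p.1, p.2} ⊆ S then x ^ #S else 0)
      ≤ #W * D * (x ^ 2 * (1 + x) ^ #W) := by
    calc _ ≤ ∑ p ∈ P, (x ^ 2 * (1 + x) ^ #W) := by
          apply sum_le_sum
          intro p hp
          rw [← sum_filter]
          have := aux_sup W {p.1, p.2} x hx0
          rwa [card_pair] at this
          simp only [hP, mem_filter] at hp
          exact hp.2.ne
      _ ≤ _ := by
          rw [sum_const, nsmul_eq_mul]
          gcongr
  have b2 : (∑ v ∈ W, ∑ S ∈ W.powerset, (if {v} ⊆ S then x ^ #S else 0)) / K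
      ≤ #W * (x * (1 + x) ^ #W) / K := by
    gcongr
    rw [← nsmul_eq_mul, ← sum_const]
    apply sum_le_sum
    intro v hv
    rw [← sum_filter]
    have := aux_sup W {v} x hx0
    rwa [card_singleton, pow_one] at this
  have : (1 + x) ^ #W * (1 - #W * D * x ^ 2 - #W * x / K) = (1 + x) ^ #W -
    #W * D * (x ^ 2 * (1 + x) ^ #W) - #W * (x * (1 + x) ^ #W) / K := by ring
  rw [this]
  linarith

open Finset Classical in
lemma aux_Q {V : Type*} [Fintype V] (K : ℕ) :
    #(univ.filter (fun S : Finset V => #S ≤ K)) ≤ (Fintype.card V + 1) ^ K := by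
  have : (univ.filter (fun S : Finset V => #S ≤ K)) ⊆
      (univ : Finset (Fin K → Option V)).image (fun f => univ.filter (fun v => ∃ i, f i = some v)) := by
    intro S hS
    simp only [mem_filter, mem_univ, true_and] at hS
    rw [mem_image]
    refine ⟨fun i => if h : (i : ℕ) < #S then some (S.equivFin.symm ⟨i, h⟩ : V) else none, mem_univ _, ?_⟩
    ext v
    simp only [mem_filter, mem_univ, true_and]
    constructor
    · rintro ⟨i, hi⟩
      split_ifs at hi with h
      · simp only [Option.some.injEq] at hi
        rw [← hi]
        exact Subtype.property _
    · intro hv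
      refine ⟨⟨S.equivFin ⟨v, hv⟩, lt_of_lt_of_le (Fin.is_lt _) hS⟩, ?_⟩
      simp
  refine (card_le_card this).trans (card_image_le.trans ?_)
  simp

open Finset Classical in
lemma aux_inter {V : Type*} [Fintype V] (G : SimpleGraph V) (I J : Finset V) (K : ℕ) :
    #(smallDef G K I ∩ smallDef G K J) ≤ 2 ^ #(I ∩ J) * ((Fintype.card V + 1) ^ K) ^ 2 := by
  set Q := (univ.filter (fun S : Finset V => #S ≤ K)) with hQ
  have : #(smallDef G K I ∩ smallDef G K J) ≤ #((I ∩ J).powerset ×ˢ (Q ×ˢ Q)) := by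
    apply card_le_card_of_injOn (fun T => (T ∩ (I ∩ J), T \ I, T \ J))
    · intro T hT
      simp only [smallDef, coe_inter, coe_filter, mem_univ, true_and, Set.mem_inter_iff,
        Set.mem_ofPred_eq] at hT
      rw [mem_coe, mem_product, mem_product, mem_powerset]
      simp only [hQ, mem_filter, mem_univ, true_and]
      exact ⟨inter_subset_right, hT.1.2, hT.2.2⟩
    · intro T _ T' _ h
      simp only [Prod.mk.injEq] at h
      obtain ⟨h1, h2, h3⟩ := h
      ext v
      have a1 := Finset.ext_iff.1 h1 v
      have a2 := Finset.ext_iff.1 h2 v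
      have a3 := Finset.ext_iff.1 h3 v
      simp only [mem_inter, mem_sdiff] at a1 a2 a3
      tauto
  refine this.trans ?_
  rw [card_product, card_product, card_powerset, sq]
  gcongr <;> exact aux_Q K

open Finset Classical in
lemma aux_union {ι α : Type*} [Fintype ι] (A : ι → Finset α) (U : Finset α) (hU : ∀ i, A i ⊆ U)
    (a b : ℝ) (ha : ∀ i, a ≤ #(A i)) (hb : ∀ i j, i ≠ j → (#(A i ∩ A j) : ℝ) ≤ b) (hb0 : 0 ≤ b) :
    Fintype.card ι * (a - Fintype.card ι * b) ≤ #U := by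
  set B : ι → Finset α := fun i => A i \ (univ.erase i).biUnion (fun j => A i ∩ A j) with hB
  have hBc : ∀ i, a - Fintype.card ι * b ≤ #(B i) := by
    intro i
    have h1 : (#((univ.erase i).biUnion (fun j => A i ∩ A j)) : ℝ) ≤ Fintype.card ι * b := by
      calc (#((univ.erase i).biUnion (fun j => A i ∩ A j)) : ℝ)
          ≤ ((∑ j ∈ univ.erase i, #(A i ∩ A j) : ℕ) : ℝ) := by exact_mod_cast card_biUnion_le
        _ ≤ ∑ j ∈ univ.erase i, b := by
            push_cast
            apply sum_le_sum
            intro j hj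
            exact hb i j (ne_of_mem_erase hj).symm
        _ ≤ _ := by
            rw [sum_const, nsmul_eq_mul]
            gcongr
            exact card_le_univ _
    have h2 : (#(A i) : ℝ) ≤ #(B i) + #((univ.erase i).biUnion (fun j => A i ∩ A j)) := by
      have := le_card_sdiff ((univ.erase i).biUnion (fun j => A i ∩ A j)) (A i)
      have h3 : #(A i) ≤ #(B i) + #((univ.erase i).biUnion (fun j => A i ∩ A j)) := by
        simp only [hB]; omega
      exact_mod_cast h3
    linarith [ha i]
  have hdis : #(univ.biUnion B) = ∑ i, #(B i) := by
    apply card_biUnion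
    intro i _ j _ hij
    show Disjoint (B i) (B j)
    rw [disjoint_left]
    intro T hT hT'
    simp only [hB, mem_sdiff, mem_biUnion, mem_erase, mem_univ, mem_inter] at hT hT'
    exact hT.2 ⟨j, ⟨hij.symm, trivial⟩, hT.1, hT'.1⟩
  have hle : #(univ.biUnion B) ≤ #U := by
    apply card_le_card
    rw [biUnion_subset]
    intro i _
    exact sdiff_subset.trans (hU i)
  calc Fintype.card ι * (a - Fintype.card ι * b) = ∑ i : ι, (a - Fintype.card ι * b) := by
        rw [sum_const, nsmul_eq_mul, card_univ]
    _ ≤ ∑ i, (#(B i) : ℝ) := sum_le_sum (fun i _ => hBc i)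
    _ = (#(univ.biUnion B) : ℝ) := by rw [hdis]; simp
    _ ≤ _ := by exact_mod_cast hle

open Finset Classical in
lemma aux_all {V ι : Type*} [Fintype V] [Fintype ι] (G : SimpleGraph V) (I : ι → Finset V)
    (d D K a M e N : ℕ) (hK : 0 < K) (hN : Fintype.card V = N) (haM : a + M = N)
    (ha : ∀ k, #(I k) = a)
    (hI : ∀ k, IsIndep G (I k : Set V))
    (hd : ∀ k v, v ∉ I k → #((I k).filter (fun u => G.Adj v u)) ≤ d)
    (hD : ∀ v, #(univ.filter (fun u => G.Adj v u)) ≤ D)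
    (he : ∀ k l, k ≠ l → #(I k ∩ I l) ≤ e) :
    Fintype.card ι * (2 ^ a * ((1 + (1 / 2 : ℝ) ^ d) ^ M *
      (1 - (M : ℝ) * D * ((1 / 2 : ℝ) ^ d) ^ 2 - (M : ℝ) * (1 / 2 : ℝ) ^ d / K)) -
      Fintype.card ι * (2 ^ e * (((N : ℝ) + 1) ^ K) ^ 2)) ≤
    (#(univ.filter (fun T : Finset V => IsIndep G (T : Set V))) : ℝ) := by
  apply aux_union (fun k => smallDef G K (I k))
  · intro k T hT
    simp only [smallDef, mem_filter, mem_univ, true_and] at hT ⊢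
    exact hT.1
  · intro k
    have := aux_class G (I k) d D K hK (hI k) (hd k) hD _ rfl
    have hc : #(I k)ᶜ = M := by rw [card_compl, ha, hN]; omega
    rw [ha, hc] at this
    exact this
  · intro k l hkl
    have h1 := aux_inter G (I k) (I l) K
    have h2 : 2 ^ #(I k ∩ I l) ≤ 2 ^ e := Nat.pow_le_pow_right (by norm_num) (he k l hkl)
    have h3 := h1.trans (Nat.mul_le_mul_right _ h2)
    rw [hN] at h3
    have h4 := (Nat.cast_le (α := ℝ)).2 h3
    push_cast at h4
    refine le_trans (le_of_eq ?_) h4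
    congr!
  · positivity

def tcoef {m : ℕ} (c : Fin m → (ZMod 3)ˣ) : Fin (m + 1) → ZMod 3 := Fin.cons 1 (fun i => (c i : ZMod 3))

def tlin {m : ℕ} (c : Fin m → (ZMod 3)ˣ) (v : Fin (m + 1) → ZMod 3) : ZMod 3 := ∑ j, tcoef c j * v j

def tcls {m : ℕ} (k : (Fin m → (ZMod 3)ˣ) × ZMod 3) : Finset (Fin (m + 1) → ZMod 3) :=
  Finset.univ.filter (fun v => tlin k.1 v = k.2)

lemma tcoef_sq {m : ℕ} (c : Fin m → (ZMod 3)ˣ) (j : Fin (m + 1)) : tcoef c j * tcoef c j = 1 := by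
  have h : ∀ u : (ZMod 3)ˣ, (u : ZMod 3) * u = 1 := by decide
  refine Fin.cases ?_ (fun i => ?_) j
  · simp [tcoef]
  · simpa [tcoef] using h (c i)

lemma tlin_succ {m : ℕ} (c : Fin m → (ZMod 3)ˣ) (v : Fin (m + 1) → ZMod 3) :
    tlin c v = v 0 + ∑ i, (c i : ZMod 3) * v i.succ := by
  simp [tlin, tcoef, Fin.sum_univ_succ]

lemma tlin_add {m : ℕ} (c : Fin m → (ZMod 3)ˣ) (v : Fin (m + 1) → ZMod 3) (j : Fin (m + 1)) (e : ZMod 3) :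
    tlin c (v + Pi.single j e) = tlin c v + tcoef c j * e := by
  simp only [tlin, Pi.add_apply, mul_add, Finset.sum_add_distrib]
  congr 1
  rw [Finset.sum_eq_single j]
  · simp
  · intro i _ hi
    simp [Pi.single_eq_of_ne hi]
  · simp

lemma torus_adj {n : ℕ} {u v : Fin n → ZMod 3} (h : (torus 3 n).Adj u v) :
    ∃ j e, e ≠ 0 ∧ v = u + Pi.single j e := by
  rw [torus, SimpleGraph.fromRel_adj] at h
  obtain ⟨hne, h⟩ := h
  obtain ⟨j, hj⟩ : ∃ j, ∀ i, i ≠ j → u i = v i := by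
    rcases h with ⟨j, -, h⟩ | ⟨j, -, h⟩
    · exact ⟨j, h⟩
    · exact ⟨j, fun i hi => (h i hi).symm⟩
  have hv : v = u + Pi.single j (v j - u j) := by
    ext i
    by_cases hi : i = j
    · subst hi; simp
    · simp [Pi.single_eq_of_ne hi, hj i hi]
  refine ⟨j, v j - u j, ?_, hv⟩
  intro h0
  rw [h0] at hv
  apply hne
  simpa using hv.symm

lemma tcls_indep {m : ℕ} (k : (Fin m → (ZMod 3)ˣ) × ZMod 3) :
    IsIndep (torus 3 (m + 1)) (tcls k : Set (Fin (m + 1) → ZMod 3)) := by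
  intro u hu v hv _ h
  obtain ⟨j, e, he, rfl⟩ := torus_adj h
  simp only [tcls, Finset.mem_coe, Finset.mem_filter, Finset.mem_univ, true_and] at hu hv
  rw [tlin_add, hu] at hv
  have h1 : tcoef k.1 j * e = 0 := by simpa using hv
  apply he
  calc e = tcoef k.1 j * tcoef k.1 j * e := by rw [tcoef_sq, one_mul]
    _ = 0 := by rw [mul_assoc, h1, mul_zero]

open Finset Classical in
lemma tcls_deg {m : ℕ} (k : (Fin m → (ZMod 3)ˣ) × ZMod 3) (v : Fin (m + 1) → ZMod 3) :
    #((tcls k).filter (fun u => (torus 3 (m + 1)).Adj v u)) ≤ m + 1 := by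
  have : (tcls k).filter (fun u => (torus 3 (m + 1)).Adj v u) ⊆
      (univ : Finset (Fin (m + 1))).image
        (fun j => v + Pi.single j (tcoef k.1 j * (k.2 - tlin k.1 v))) := by
    intro u hu
    rw [mem_filter] at hu
    obtain ⟨hu, h⟩ := hu
    obtain ⟨j, e, he, rfl⟩ := torus_adj h
    rw [mem_image]
    refine ⟨j, mem_univ _, ?_⟩
    simp only [tcls, mem_filter, mem_univ, true_and] at hu
    rw [tlin_add] at hu
    congr 2
    rw [← hu, add_sub_cancel_left, ← mul_assoc, tcoef_sq, one_mul]
  refine (card_le_card this).trans (card_image_le.trans ?_)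
  simp

open Finset Classical in
lemma torus_deg {n : ℕ} (v : Fin n → ZMod 3) :
    #(univ.filter (fun u => (torus 3 n).Adj v u)) ≤ n * 3 := by
  have : univ.filter (fun u => (torus 3 n).Adj v u) ⊆
      (univ : Finset (Fin n × ZMod 3)).image (fun p => v + Pi.single p.1 p.2) := by
    intro u hu
    rw [mem_filter] at hu
    obtain ⟨j, e, he, rfl⟩ := torus_adj hu.2
    rw [mem_image]
    exact ⟨(j, e), mem_univ _, rfl⟩
  refine (card_le_card this).trans (card_image_le.trans ?_)
  simp

open Finset in
lemma tcls_card {m : ℕ} (k : (Fin m → (ZMod 3)ˣ) × ZMod 3) : #(tcls k) = 3 ^ m := by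
  have : #(tcls k) = #(univ : Finset (Fin m → ZMod 3)) := by
    apply card_nbij' (fun v => Fin.tail v)
      (fun w => Fin.cons (k.2 - ∑ i, (k.1 i : ZMod 3) * w i) w)
    · intro v _; simp
    · intro w _
      simp [tcls, tlin_succ]
    · intro v hv
      simp only [tcls, coe_filter, mem_univ, true_and, Set.mem_ofPred_eq, tlin_succ] at hv
      ext i
      refine Fin.cases ?_ (fun i => ?_) i
      · simp [← hv, Fin.tail]
      · simp [Fin.tail]
    · intro w _
      simp
  rw [this]
  simp

open Finset in
lemma tcls_inter {m : ℕ} (k l : (Fin m → (ZMod 3)ˣ) × ZMod 3) (h : k ≠ l) :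
    #(tcls k ∩ tcls l) ≤ 3 ^ (m - 1) := by
  by_cases hc : k.1 = l.1
  · have : tcls k ∩ tcls l = ∅ := by
      rw [eq_empty_iff_forall_notMem]
      intro v hv
      simp only [tcls, mem_inter, mem_filter, mem_univ, true_and] at hv
      apply h
      apply Prod.ext hc
      rw [← hv.1, ← hv.2, hc]
    rw [this]; simp
  · obtain ⟨i, hi⟩ := Function.ne_iff.1 hc
    have : #(tcls k ∩ tcls l) ≤ #(univ : Finset ({j : Fin m // j ≠ i} → ZMod 3)) := by
      apply card_le_card_of_injOn (fun v j => v j.1.succ) (by intro v _; simp)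
      intro v hv w hw hvw
      simp only [tcls, coe_inter, coe_filter, mem_univ, true_and, Set.mem_inter_iff,
        Set.mem_ofPred_eq, tlin_succ] at hv hw
      have hj : ∀ j, j ≠ i → v j.succ = w j.succ := fun j hj => congrFun hvw ⟨j, hj⟩
      have hs : ∀ c : Fin m → (ZMod 3)ˣ, ∑ j, (c j : ZMod 3) * v j.succ - ∑ j, (c j : ZMod 3) * w j.succ
          = c i * (v i.succ - w i.succ) := by
        intro c
        rw [← sum_sub_distrib, sum_eq_single i]
        · ring
        · intro j _ hji
          rw [hj j hji, sub_self]
        · simp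
      have h1 : v 0 - w 0 + k.1 i * (v i.succ - w i.succ) = 0 := by
        rw [← hs]; linear_combination hv.1 - hw.1
      have h2 : v 0 - w 0 + l.1 i * (v i.succ - w i.succ) = 0 := by
        rw [← hs]; linear_combination hv.2 - hw.2
      have fact : ∀ (a b : (ZMod 3)ˣ) (s t : ZMod 3), a ≠ b → s + a * t = 0 → s + b * t = 0 →
          s = 0 ∧ t = 0 := by decide
      obtain ⟨e1, e2⟩ := fact _ _ _ _ hi h1 h2
      ext j
      refine Fin.cases (sub_eq_zero.1 e1) (fun j => ?_) j
      by_cases hji : j = i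
      · rw [hji]; exact sub_eq_zero.1 e2
      · exact hj j hji
    refine this.trans ?_
    simp

lemma aux_growth (k : ℕ) (hk : 15 ≤ k) : 2 * k + 4 + 16 * (k + 2) * 2 ^ k ≤ 2 * 3 ^ k := by
  induction k, hk using Nat.le_induction with
  | base => norm_num
  | succ k hk ih =>
    rw [pow_succ, pow_succ]
    nlinarith [Nat.zero_le (k * 2 ^ k)]

lemma aux_b (m : ℕ) (hm : 16 ≤ m) :
    3 * (2 : ℝ) ^ m * (2 ^ 3 ^ (m - 1) * ((3 ^ (m + 1) + 1) ^ 2 ^ (m + 1)) ^ 2) ≤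
      2 ^ 3 ^ m * (1 / 2) ^ m := by
  obtain ⟨k, rfl⟩ : ∃ k, m = k + 1 := ⟨m - 1, by omega⟩
  have hg := aux_growth k (by omega)
  have h1 : (3 : ℝ) ^ (k + 1 + 1) + 1 ≤ 2 ^ (2 * (k + 2)) := by
    have : 3 ^ (k + 1 + 1) < 4 ^ (k + 2) := Nat.pow_lt_pow_left (by norm_num) (by omega)
    rw [pow_mul]
    norm_num
    exact_mod_cast this
  rw [one_div, inv_pow, ← div_eq_mul_inv, le_div_iff₀ (by positivity), Nat.add_sub_cancel]
  calc 3 * (2 : ℝ) ^ (k + 1) * (2 ^ 3 ^ k * ((3 ^ (k + 1 + 1) + 1) ^ 2 ^ (k + 1 + 1)) ^ 2) * 2 ^ (k + 1)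
      ≤ 2 ^ 2 * (2 : ℝ) ^ (k + 1) * (2 ^ 3 ^ k * ((2 ^ (2 * (k + 2))) ^ 2 ^ (k + 1 + 1)) ^ 2) * 2 ^ (k + 1) := by
        gcongr
        norm_num
    _ = 2 ^ (2 + (k + 1) + (3 ^ k + (2 * (k + 2)) * 2 ^ (k + 1 + 1) * 2) + (k + 1)) := by
        simp only [pow_add, ← pow_mul]
    _ ≤ 2 ^ 3 ^ (k + 1) := by
        apply pow_le_pow_right₀ (by norm_num)
        have : 2 * (k + 2) * 2 ^ (k + 1 + 1) * 2 = 16 * (k + 2) * 2 ^ k := by ring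
        rw [this, pow_succ 3 k]
        omega

lemma aux_exp (x : ℝ) (hx : 0 ≤ x) (M : ℕ) :
    Real.exp (M * x) * (1 - M * x ^ 2) ≤ (1 + x) ^ M := by
  have h1 : Real.exp (x - x ^ 2) ≤ 1 + x := by
    have h2 := Real.add_one_le_exp (-(x / (1 + x)))
    have h3 : -(x / (1 + x)) + 1 = (1 + x)⁻¹ := by field_simp; ring
    rw [h3, Real.exp_neg] at h2
    have h4 := (inv_le_inv₀ (by positivity) (Real.exp_pos _)).1 h2
    refine le_trans (Real.exp_le_exp.2 ?_) h4
    rw [le_div_iff₀ (by positivity)]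
    nlinarith [pow_nonneg hx 3]
  calc Real.exp (M * x) * (1 - M * x ^ 2) ≤ Real.exp (M * x) * Real.exp (-(M * x ^ 2)) := by
        gcongr
        linarith [Real.add_one_le_exp (-(M * x ^ 2))]
    _ = Real.exp (x - x ^ 2) ^ M := by
        rw [← Real.exp_add, ← Real.exp_nat_mul]; congr 1; ring
    _ ≤ _ := by gcongr

lemma aux_tendsto : Filter.Tendsto (fun m : ℕ => (3 * (m : ℝ) + 7 / 2) * (3 / 4) ^ m + (1 / 2 : ℝ) ^ m)
    Filter.atTop (nhds 0) := by
  have h1 := tendsto_self_mul_const_pow_of_abs_lt_one (r := (3 / 4 : ℝ)) (by rw [abs_lt]; norm_num)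
  have h2 := tendsto_pow_atTop_nhds_zero_of_lt_one (r := (3 / 4 : ℝ)) (by norm_num) (by norm_num)
  have h3 := tendsto_pow_atTop_nhds_zero_of_lt_one (r := (1 / 2 : ℝ)) (by norm_num) (by norm_num)
  have := ((h1.const_mul 3).add (h2.const_mul (7 / 2))).add h3
  simp only [mul_zero, add_zero] at this
  refine this.congr (fun m => ?_)
  ring

open Finset Classical in
lemma aux_count (m : ℕ) :
    3 * (2 : ℝ) ^ m * (2 ^ 3 ^ m * ((1 + (1 / 2 : ℝ) ^ (m + 1)) ^ (2 * 3 ^ m) *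
      (1 - ((2 * 3 ^ m : ℕ) : ℝ) * ((m + 1) * 3 : ℕ) * ((1 / 2 : ℝ) ^ (m + 1)) ^ 2 -
        ((2 * 3 ^ m : ℕ) : ℝ) * (1 / 2 : ℝ) ^ (m + 1) / (2 ^ (m + 1) : ℕ))) -
      3 * (2 : ℝ) ^ m * (2 ^ 3 ^ (m - 1) * ((3 ^ (m + 1) + 1) ^ 2 ^ (m + 1)) ^ 2)) ≤
    (Nat.card {s : Set (Fin (m + 1) → ZMod 3) // IsIndep (torus 3 (m + 1)) s} : ℝ) := by
  set G := torus 3 (m + 1) with hG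
  have hι : Fintype.card ((Fin m → (ZMod 3)ˣ) × ZMod 3) = 3 * 2 ^ m := by
    have : Fintype.card (ZMod 3)ˣ = 2 := by decide
    rw [Fintype.card_prod, Fintype.card_fun, this, ZMod.card, Fintype.card_fin, mul_comm]
  have hU : Nat.card {s : Set (Fin (m + 1) → ZMod 3) // IsIndep G s} =
      #(univ.filter (fun T : Finset (Fin (m + 1) → ZMod 3) =>
        IsIndep G (T : Set (Fin (m + 1) → ZMod 3)))) := by
    rw [← Fintype.card_subtype, ← Nat.card_eq_fintype_card]
    apply Nat.card_congr
    exact (Equiv.subtypeEquiv Fintype.finsetEquivSet (fun T => by simp)).symm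
  rw [hU]
  have main := aux_all G (fun k : (Fin m → (ZMod 3)ˣ) × ZMod 3 => tcls k) (m + 1) ((m + 1) * 3)
    (2 ^ (m + 1)) (3 ^ m) (2 * 3 ^ m) (3 ^ (m - 1)) (3 ^ (m + 1)) (by positivity)
    (by rw [Fintype.card_fun, ZMod.card, Fintype.card_fin]) (by rw [pow_succ]; ring)
    tcls_card tcls_indep (fun k v _ => by convert tcls_deg k v) (fun v => by convert torus_deg v)
    (fun k l hkl => by convert tcls_inter k l hkl)
  rw [hι] at main
  push_cast at main ⊢
  exact main

/-- There are at least `(1-o(1)) · 3 · 2^(n-1) · 2^(3^(n-1)) · exp((3/2)^(n-1))`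
independent sets in `Z_3^n`. -/
theorem stmt_0 (ε : ℝ) (hε : 0 < ε) :
    ∃ n₀ : ℕ, ∀ n : ℕ, n₀ ≤ n →
      (1 - ε) * 3 * 2 ^ (n - 1) * 2 ^ 3 ^ (n - 1) * Real.exp (((3 : ℝ) / 2) ^ (n - 1)) ≤
        (Nat.card {s : Set (Fin n → ZMod 3) // IsIndep (torus 3 n) s} : ℝ) := by
  have hev := aux_tendsto.eventually (gt_mem_nhds (lt_min hε one_pos))
  obtain ⟨n₁, hn₁⟩ := Filter.eventually_atTop.1 hev
  refine ⟨max n₁ 16 + 1, fun n hn => ?_⟩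
  obtain ⟨m, rfl⟩ : ∃ m, n = m + 1 := ⟨n - 1, by omega⟩
  rw [Nat.add_sub_cancel]
  have hm1 : n₁ ≤ m := by have := le_max_left n₁ 16; omega
  have hm2 : 16 ≤ m := by have := le_max_right n₁ 16; omega
  have hf := hn₁ m hm1
  rw [lt_min_iff] at hf
  refine le_trans ?_ (aux_count m)
  have hb := aux_b m hm2
  set b := 3 * (2 : ℝ) ^ m * (2 ^ 3 ^ (m - 1) * ((3 ^ (m + 1) + 1) ^ 2 ^ (m + 1)) ^ 2) with hbdef
  have hexp := aux_exp ((1 / 2 : ℝ) ^ (m + 1)) (by positivity) (2 * 3 ^ m)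
  set x := (1 / 2 : ℝ) ^ (m + 1) with hx
  have h34 : (3 : ℝ) ^ m * (x * x) = (3 / 4) ^ m / 4 := by
    have : x * x = (1 / 4) ^ m / 4 := by
      rw [hx, ← mul_pow, pow_succ]; norm_num; ring
    rw [this, ← mul_div_assoc, ← mul_pow]; norm_num
  have e1 : ((2 * 3 ^ m : ℕ) : ℝ) * ((m + 1) * 3 : ℕ) * x ^ 2 = (3 / 2) * (m + 1) * (3 / 4) ^ m := by
    push_cast
    linear_combination (6 * (m + 1 : ℝ)) * h34
  have e2 : ((2 * 3 ^ m : ℕ) : ℝ) * x / (2 ^ (m + 1) : ℕ) = (1 / 2) * (3 / 4) ^ m := by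
    have : (((2 ^ (m + 1) : ℕ) : ℝ))⁻¹ = x := by rw [hx]; push_cast; simp
    rw [div_eq_mul_inv, this]
    push_cast
    linear_combination 2 * h34
  have e3 : ((2 * 3 ^ m : ℕ) : ℝ) * x ^ 2 = (1 / 2) * (3 / 4) ^ m := by
    push_cast
    linear_combination 2 * h34
  have e4 : ((2 * 3 ^ m : ℕ) : ℝ) * x = (3 / 2) ^ m := by
    rw [hx, pow_succ, div_pow 3 2, one_div, inv_pow]
    push_cast
    field_simp
  rw [e3, e4] at hexp
  rw [e1, e2]
  set q := (3 / 4 : ℝ) ^ m with hq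
  have hq0 : 0 ≤ q := by positivity
  have hmq : 0 ≤ (m : ℝ) * q := by positivity
  set E := Real.exp ((3 / 2 : ℝ) ^ m) with hE
  have hE1 : 1 ≤ E := Real.one_le_exp (by positivity)
  set t := (1 / 2 : ℝ) ^ m with ht
  have ht0 : 0 ≤ t := by positivity
  have k1 : (1 - ε) * E ≤ (1 + x) ^ (2 * 3 ^ m) * (1 - (3 / 2) * (m + 1) * q - (1 / 2) * q) - t := by
    have hpos : 0 ≤ 1 - (3 / 2) * (m + 1) * q - (1 / 2) * q := by nlinarith [hf.2]
    have s1 := mul_le_mul_of_nonneg_right hexp hpos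
    have s2 : t ≤ E * t := by nlinarith
    have s3 : E * (1 - ε) ≤ E * ((1 - 1 / 2 * q) * (1 - (3 / 2) * (m + 1) * q - (1 / 2) * q) - t) := by
      apply mul_le_mul_of_nonneg_left _ (by linarith)
      have p1 : 0 ≤ (1 / 2 * q) * ((3 / 2) * (m + 1) * q + (1 / 2) * q) := by positivity
      nlinarith [hf.1]
    nlinarith
  have hP : (0 : ℝ) ≤ 2 ^ 3 ^ m := by positivity
  calc (1 - ε) * 3 * 2 ^ m * 2 ^ 3 ^ m * E = 3 * 2 ^ m * (2 ^ 3 ^ m * ((1 - ε) * E)) := by ring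
    _ ≤ _ := by
      apply mul_le_mul_of_nonneg_left _ (by positivity)
      have := mul_le_mul_of_nonneg_left k1 hP
      linarith
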